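/- Let B > 0, ρ ∈ (0, 1/2), and let μ and ν be nondegenerate Borel probability measures on ℝ with ∫x² dμ(x) < ∞, ∫x² dν(x) < ∞ and ∫x dν(x) ≤ ∫x dμ(x). For λ > 0, set L^ρ_{ν,λ+B} = inf{s ∈ ℝ : H_{ν,λ+B}(s) ≥ ρ} and U^ρ_{μ,λ} = sup{s ∈ ℝ : 1 − H_{μ,λ}(s) ≥ ρ}. Then there exists λ* > 0 such that L^ρ_{ν,λ+B} < U^ρ_{μ,λ} for all λ ≥ λ*. (Lemma A.10, first part: separation of compound Poisson quantiles for large intensity.) -/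

import Mathlib

open MeasureTheory Filter Set

noncomputable section

/-- `j`-fold convolution power of a measure on `ℝ` (the law of a sum of `j` i.i.d.
copies); `convPow ν 0` is the Dirac mass at `0`. -/
def convPow (ν : Measure ℝ) : ℕ → Measure ℝ
  | 0 => Measure.dirac 0
  | (j + 1) => (convPow ν j).conv ν

/-- The compound Poisson law with intensity `lam` and compounding distribution `ν`:
the law of `Σ_{j=1}^N ξ_j` with `N ~ Poisson(lam)`, `(ξ_j)` i.i.d. with law `ν`,
independent of `N`. -/
def compoundPoisson (lam : ℝ) (ν : Measure ℝ) : Measure ℝ :=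
  Measure.sum (fun j : ℕ =>
    (ENNReal.ofReal (Real.exp (-lam) * lam ^ j / (Nat.factorial j))) • convPow ν j)


open ProbabilityTheory Topology

instance isProbabilityMeasure_convPow (ν : Measure ℝ) [IsProbabilityMeasure ν] (j : ℕ) :
    IsProbabilityMeasure (convPow ν j) := by
  induction j with
  | zero => exact inferInstanceAs (IsProbabilityMeasure (Measure.dirac (0 : ℝ)))
  | succ j ih => exact inferInstanceAs (IsProbabilityMeasure ((convPow ν j).conv ν))

theorem charFun_convPow (ν : Measure ℝ) [IsProbabilityMeasure ν] (j : ℕ) (t : ℝ) :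
    charFun (convPow ν j) t = charFun ν t ^ j := by
  induction j with
  | zero => simp [convPow, charFun_dirac]
  | succ j ih => rw [convPow, charFun_conv, ih, pow_succ]

theorem isProbabilityMeasure_compoundPoisson (ν : Measure ℝ) [IsProbabilityMeasure ν] {lam : ℝ}
    (hlam : 0 ≤ lam) : IsProbabilityMeasure (compoundPoisson lam ν) := by
  constructor
  have h : HasSum (fun j : ℕ => Real.exp (-lam) * lam ^ j / (Nat.factorial j)) 1 := by
    have h := (NormedSpace.expSeries_div_hasSum_exp (𝔸 := ℝ) lam).mul_left (Real.exp (-lam))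
    rw [← Real.exp_eq_exp_ℝ, ← Real.exp_add, neg_add_cancel, Real.exp_zero] at h
    simpa only [mul_div_assoc] using h
  simp only [compoundPoisson, Measure.sum_apply _ MeasurableSet.univ, Measure.smul_apply,
    measure_univ, smul_eq_mul, mul_one]
  rw [← ENNReal.ofReal_tsum_of_nonneg (fun j => by positivity) h.summable, h.tsum_eq,
    ENNReal.ofReal_one]

theorem charFun_compoundPoisson (ν : Measure ℝ) [IsProbabilityMeasure ν] {lam : ℝ}
    (hlam : 0 ≤ lam) (t : ℝ) :
    charFun (compoundPoisson lam ν) t = Complex.exp (lam * (charFun ν t - 1)) := by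
  have := isProbabilityMeasure_compoundPoisson ν hlam
  have hint : Integrable (fun x : ℝ => Complex.exp (t * x * Complex.I))
      (compoundPoisson lam ν) := by
    refine Integrable.of_bound (by fun_prop) 1 (.of_forall fun x => ?_)
    rw [← Complex.ofReal_mul, Complex.norm_exp_ofReal_mul_I]
  have h1 := hasSum_integral_measure hint
  have h2 := (NormedSpace.expSeries_div_hasSum_exp (𝔸 := ℂ) (lam * charFun ν t)).mul_left
    (Complex.exp (-lam))
  rw [← Complex.exp_eq_exp_ℂ, ← Complex.exp_add] at h2
  rw [charFun_apply_real, mul_sub, mul_one, sub_eq_neg_add]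
  refine h1.unique ?_
  convert! h2 using 2 with j
  rw [integral_smul_measure, ← charFun_apply_real, charFun_convPow,
    ENNReal.toReal_ofReal (by positivity), Complex.real_smul]
  push_cast
  ring

theorem isLittleO_charFun_sub_taylor_two (μ : Measure ℝ) [IsProbabilityMeasure μ]
    (hμ2 : Integrable (fun x => x ^ 2) μ) :
    (fun t : ℝ => charFun μ t - (1 + ((∫ x, x ∂μ : ℝ) : ℂ) * t * Complex.I -
      ((∫ x, x ^ 2 ∂μ : ℝ) : ℂ) * t ^ 2 / 2)) =o[𝓝 0] fun t : ℝ => t ^ 2 := by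
  have hL : MemLp id 2 μ := (memLp_two_iff_integrable_sq (by fun_prop)).2 hμ2
  have ht (t : ℝ) := taylorWithinEval_charFun_two_zero (P := μ) (X := id) aemeasurable_id
    (by simpa using hL) t
  simp only [Measure.map_id, id, Pi.pow_apply] at ht
  simp_rw [← ht]
  convert! taylor_isLittleO_univ (contDiff_charFun (n := 2) hL) (x₀ := 0)
  simp

/-- The centred and rescaled characteristic function of a compound Poisson law converges to that
of a Gaussian law. -/
theorem tendsto_cexp_mul_charFun_sub (μ : Measure ℝ) [IsProbabilityMeasure μ]
    (hμ2 : Integrable (fun x => x ^ 2) μ) (t : ℝ) :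
    Tendsto (fun lam : ℝ => Complex.exp (lam * (charFun μ ((√lam)⁻¹ * t) - 1 -
      ((∫ x, x ∂μ : ℝ) : ℂ) * ((√lam)⁻¹ * t : ℝ) * Complex.I))) atTop
      (𝓝 (Complex.exp (-(((∫ x, x ^ 2 ∂μ : ℝ) : ℂ) * t ^ 2 / 2)))) := by
  refine (Complex.continuous_exp.tendsto _).comp ?_
  have hs : Tendsto (fun lam : ℝ => (√lam)⁻¹ * t) atTop (𝓝 0) := by
    simpa using (tendsto_inv_atTop_zero.comp Real.tendsto_sqrt_atTop).mul_const t
  have h := (isLittleO_charFun_sub_taylor_two μ hμ2).comp_tendsto hs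
  have h' := ((Asymptotics.isBigO_refl (fun lam : ℝ => (lam : ℂ)) atTop).mul_isLittleO
    (h.trans_isBigO (Asymptotics.isBigO_of_le (g := fun lam : ℝ => (((√lam)⁻¹ * t : ℝ) : ℂ) ^ 2)
      _ fun lam => by simp)))
  have hsq : ∀ᶠ lam : ℝ in atTop, (lam : ℂ) * (((√lam)⁻¹ * t : ℝ) : ℂ) ^ 2 = (t : ℂ) ^ 2 := by
    filter_upwards [eventually_gt_atTop 0] with lam hlam
    norm_cast
    rw [mul_pow, inv_pow, Real.sq_sqrt hlam.le, mul_inv_cancel_left₀ hlam.ne']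
  have h0 := (Asymptotics.isLittleO_one_iff ℂ).1 ((h'.trans_eventuallyEq hsq).trans_isBigO
    (Asymptotics.isBigO_const_const ((t : ℂ) ^ 2) one_ne_zero atTop))
  have h1 := h0.sub_const (((∫ x, x ^ 2 ∂μ : ℝ) : ℂ) * t ^ 2 / 2)
  rw [zero_sub] at h1
  refine h1.congr' ?_
  filter_upwards [hsq] with lam hlam
  rw [← hlam]
  simp only [Function.comp_apply]
  ring

theorem charFun_map_compoundPoisson (μ : Measure ℝ) [IsProbabilityMeasure μ] {lam : ℝ}
    (hlam : 0 ≤ lam) (a m t : ℝ) :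
    charFun ((compoundPoisson lam μ).map fun x => a * (x - lam * m)) t =
      Complex.exp (lam * (charFun μ (a * t) - 1 - (m : ℂ) * (a * t : ℝ) * Complex.I)) := by
  have hmap : (compoundPoisson lam μ).map (fun x => a * (x - lam * m)) =
      ((compoundPoisson lam μ).map (· + -(lam * m))).map (a * ·) := by
    rw [Measure.map_map (by fun_prop) (by fun_prop)]
    rfl
  rw [hmap, charFun_map_mul, charFun_map_add_const, charFun_compoundPoisson μ hlam,
    ← Complex.exp_add]
  congr 1
  simp only [RCLike.inner_apply, conj_trivial]
  push_cast
  ring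

/-- Central limit theorem for compound Poisson laws, as a lower bound on open sets. -/
theorem eventually_lt_compoundPoisson_preimage (μ : Measure ℝ) [IsProbabilityMeasure μ]
    (hμ2 : Integrable (fun x => x ^ 2) μ) {G : Set ℝ} (hG : IsOpen G) {r : ENNReal}
    (hr : r < gaussianReal 0 (∫ x, x ^ 2 ∂μ).toNNReal G) :
    ∀ᶠ lam in atTop, r < compoundPoisson lam μ
      ((fun x => (√lam)⁻¹ * (x - lam * ∫ x, x ∂μ)) ⁻¹' G) := by
  by_contra hcon
  obtain ⟨u, hu, hfail⟩ := exists_seq_forall_of_frequently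
    ((not_eventually.1 hcon).and_eventually (eventually_gt_atTop 0))
  have hprob (n : ℕ) : IsProbabilityMeasure ((compoundPoisson (u n) μ).map
      fun x => (√(u n))⁻¹ * (x - u n * ∫ x, x ∂μ)) := by
    have := isProbabilityMeasure_compoundPoisson μ (hfail n).2.le
    exact Measure.isProbabilityMeasure_map (by fun_prop)
  have hlim : Tendsto (β := ProbabilityMeasure ℝ) (fun n => ⟨_, hprob n⟩) atTop
      (𝓝 ⟨gaussianReal 0 (∫ x, x ^ 2 ∂μ).toNNReal, inferInstance⟩) := by
    refine ProbabilityMeasure.tendsto_of_tendsto_charFun fun t => ?_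
    simp only [ProbabilityMeasure.coe_mk, charFun_gaussianReal,
      charFun_map_compoundPoisson μ (hfail _).2.le]
    have hnonneg : 0 ≤ ∫ x, x ^ 2 ∂μ := integral_nonneg fun x => sq_nonneg x
    convert! (tendsto_cexp_mul_charFun_sub μ hμ2 t).comp hu using 3
    simp [hnonneg]
  have hle := ProbabilityMeasure.le_liminf_measure_open_of_tendsto hlim hG
  obtain ⟨n, hn⟩ := (eventually_lt_of_lt_liminf (hr.trans_le hle)).exists
  rw [ProbabilityMeasure.coe_mk, Measure.map_apply (by fun_prop) hG.measurableSet] at hn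
  exact (hfail n).1 hn

theorem gaussianReal_zero_Iio_neg (v : NNReal) (c : ℝ) :
    gaussianReal 0 v (Iio (-c)) = gaussianReal 0 v (Ioi c) := by
  conv_rhs => rw [← neg_zero, ← gaussianReal_map_neg]
  rw [Measure.map_apply (by fun_prop) measurableSet_Ioi]
  congr 1
  ext x
  simp

theorem gaussianReal_Ioi_zero {v : NNReal} (hv : v ≠ 0) :
    gaussianReal 0 v (Ioi 0) = 2⁻¹ := by
  have := nullSingletonClass_gaussianReal (μ := 0) hv
  have hneg := gaussianReal_zero_Iio_neg v 0
  rw [neg_zero] at hneg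
  have h : gaussianReal 0 v (Iic 0) + gaussianReal 0 v (Ioi 0) = 1 := by
    rw [← compl_Iic, measure_add_measure_compl measurableSet_Iic, measure_univ]
  rw [← measure_congr Iio_ae_eq_Iic, hneg, ← two_mul] at h
  exact ENNReal.eq_inv_of_mul_eq_one_left (by rwa [mul_comm])

theorem exists_pos_lt_gaussianReal_Ioi {v : NNReal} (hv : v ≠ 0) {r : ENNReal} (hr : r < 2⁻¹) :
    ∃ c > 0, r < gaussianReal 0 v (Ioi c) := by
  have hU : ⋃ n : ℕ, Ioi (1 / ((n : ℝ) + 1)) = Ioi 0 := by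
    ext x
    simp only [mem_iUnion, mem_Ioi]
    exact ⟨fun ⟨n, hn⟩ => Nat.one_div_pos_of_nat.trans hn, exists_nat_one_div_lt⟩
  have hmono : Monotone fun n : ℕ => Ioi (1 / ((n : ℝ) + 1)) :=
    fun m n h => Ioi_subset_Ioi (Nat.one_div_le_one_div h)
  have ht := tendsto_measure_iUnion_atTop (μ := gaussianReal 0 v) hmono
  rw [hU, gaussianReal_Ioi_zero hv] at ht
  obtain ⟨n, hn⟩ := (ht.eventually (lt_mem_nhds hr)).exists
  exact ⟨_, Nat.one_div_pos_of_nat, hn⟩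

theorem integral_sq_pos_of_ne_dirac_zero {μ : Measure ℝ} [IsProbabilityMeasure μ]
    (hμ : μ ≠ Measure.dirac 0) (hμ2 : Integrable (fun x => x ^ 2) μ) : 0 < ∫ x, x ^ 2 ∂μ := by
  refine (integral_nonneg fun x => sq_nonneg x).lt_of_ne' fun h => hμ ?_
  rw [integral_eq_zero_iff_of_nonneg (fun x => sq_nonneg x) hμ2] at h
  have h' : (id : ℝ → ℝ) =ᵐ[μ] fun _ => 0 := by
    filter_upwards [h] with x hx
    simpa using hx
  rw [← Measure.map_id (μ := μ), Measure.map_congr h', Measure.map_const, measure_univ, one_smul]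

theorem bddBelow_setOf_le_toReal_Iic (μ : Measure ℝ) [IsProbabilityMeasure μ] {ρ : ℝ}
    (hρ : 0 < ρ) : BddBelow {s : ℝ | ρ ≤ (μ (Iic s)).toReal} := by
  have ht : Tendsto (fun s => (μ (Iic s)).toReal) atBot (𝓝 0) :=
    (tendsto_cdf_atBot μ).congr (cdf_eq_real μ)
  obtain ⟨b, hb⟩ := eventually_atBot.1 (ht.eventually (gt_mem_nhds hρ))
  exact ⟨b, fun s hs => le_of_not_ge fun h => (hb s h).not_ge hs⟩

theorem bddAbove_setOf_le_one_sub_toReal_Iic (μ : Measure ℝ) [IsProbabilityMeasure μ] {ρ : ℝ}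
    (hρ : 0 < ρ) : BddAbove {s : ℝ | ρ ≤ 1 - (μ (Iic s)).toReal} := by
  have ht : Tendsto (fun s => 1 - (μ (Iic s)).toReal) atTop (𝓝 0) := by
    simpa [cdf_eq_real, measureReal_def] using (tendsto_cdf_atTop μ).const_sub 1
  obtain ⟨b, hb⟩ := eventually_atTop.1 (ht.eventually (gt_mem_nhds hρ))
  exact ⟨b, fun s hs => le_of_not_ge fun h => (hb s h).not_ge hs⟩

/-- For `ρ < 1 / 2`, the lower `ρ`-quantile of a compound Poisson law of intensity `lam` lies below
its mean by at least a multiple of `√lam`, for large `lam`. -/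
theorem exists_pos_eventually_sInf_le (μ : Measure ℝ) [IsProbabilityMeasure μ]
    (hμ : μ ≠ Measure.dirac 0) (hμ2 : Integrable (fun x => x ^ 2) μ) {ρ : ℝ} (hρ0 : 0 < ρ)
    (hρ : ρ < 1 / 2) :
    ∃ c > 0, ∀ᶠ lam in atTop, sInf {s : ℝ | ρ ≤ ((compoundPoisson lam μ) (Iic s)).toReal} ≤
      lam * (∫ x, x ∂μ) - c * √lam := by
  have hv : (∫ x, x ^ 2 ∂μ).toNNReal ≠ 0 :=
    (Real.toNNReal_pos.2 (integral_sq_pos_of_ne_dirac_zero hμ hμ2)).ne'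
  have hr : ENNReal.ofReal ρ < 2⁻¹ := by
    rw [ENNReal.ofReal_lt_iff_lt_toReal hρ0.le (by simp)]
    simpa using hρ
  obtain ⟨c, hc, h⟩ := exists_pos_lt_gaussianReal_Ioi hv hr
  rw [← gaussianReal_zero_Iio_neg] at h
  refine ⟨c, hc, ?_⟩
  filter_upwards [eventually_lt_compoundPoisson_preimage μ hμ2 isOpen_Iio h,
    eventually_gt_atTop 0] with lam hlam hpos
  have := isProbabilityMeasure_compoundPoisson μ hpos.le
  refine csInf_le (bddBelow_setOf_le_toReal_Iic _ hρ0) ?_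
  refine (ENNReal.ofReal_le_iff_le_toReal (measure_ne_top _ _)).1
    (hlam.le.trans (measure_mono fun x hx => ?_))
  rw [mem_preimage, mem_Iio, inv_mul_lt_iff₀ (Real.sqrt_pos.2 hpos)] at hx
  rw [mem_Iic]
  linarith

/-- For `ρ < 1 / 2`, the upper `ρ`-quantile of a compound Poisson law of intensity `lam` lies above
its mean by at least a multiple of `√lam`, for large `lam`. -/
theorem exists_pos_eventually_le_sSup (μ : Measure ℝ) [IsProbabilityMeasure μ]
    (hμ : μ ≠ Measure.dirac 0) (hμ2 : Integrable (fun x => x ^ 2) μ) {ρ : ℝ} (hρ0 : 0 < ρ)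
    (hρ : ρ < 1 / 2) :
    ∃ c > 0, ∀ᶠ lam in atTop, lam * (∫ x, x ∂μ) + c * √lam ≤
      sSup {s : ℝ | ρ ≤ 1 - ((compoundPoisson lam μ) (Iic s)).toReal} := by
  have hv : (∫ x, x ^ 2 ∂μ).toNNReal ≠ 0 :=
    (Real.toNNReal_pos.2 (integral_sq_pos_of_ne_dirac_zero hμ hμ2)).ne'
  have hr : ENNReal.ofReal ρ < 2⁻¹ := by
    rw [ENNReal.ofReal_lt_iff_lt_toReal hρ0.le (by simp)]
    simpa using hρ
  obtain ⟨c, hc, h⟩ := exists_pos_lt_gaussianReal_Ioi hv hr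
  refine ⟨c, hc, ?_⟩
  filter_upwards [eventually_lt_compoundPoisson_preimage μ hμ2 isOpen_Ioi h,
    eventually_gt_atTop 0] with lam hlam hpos
  have := isProbabilityMeasure_compoundPoisson μ hpos.le
  refine le_csSup (bddAbove_setOf_le_one_sub_toReal_Iic _ hρ0) ?_
  have hcompl := probReal_compl_eq_one_sub (μ := compoundPoisson lam μ)
    (measurableSet_Iic (a := lam * (∫ x, x ∂μ) + c * √lam))
  rw [mem_ofPred_eq, ← measureReal_def, ← hcompl, compl_Iic]
  refine (ENNReal.ofReal_le_iff_le_toReal (measure_ne_top _ _)).1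
    (hlam.le.trans (measure_mono fun x hx => ?_))
  rw [mem_preimage, mem_Ioi, lt_inv_mul_iff₀ (Real.sqrt_pos.2 hpos)] at hx
  rw [mem_Ioi]
  linarith

/-- Lemma A.10 (first part): separation of compound Poisson quantiles for large
intensity, where `L^ρ_{ν,λ+B} = inf {s | H_{ν,λ+B}(s) ≥ ρ}` and
`U^ρ_{μ,λ} = sup {s | 1 − H_{μ,λ}(s) ≥ ρ}`. -/
theorem stmt19 (B ρ : ℝ) (hB : 0 < B) (hρ0 : 0 < ρ) (hρ : ρ < 1 / 2)
    (μ ν : Measure ℝ) [IsProbabilityMeasure μ] [IsProbabilityMeasure ν]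
    (hμnd : ∀ x : ℝ, μ ≠ Measure.dirac x) (hνnd : ∀ x : ℝ, ν ≠ Measure.dirac x)
    (hμ2 : Integrable (fun x => x ^ 2) μ) (hν2 : Integrable (fun x => x ^ 2) ν)
    (hmean : ∫ x, x ∂ν ≤ ∫ x, x ∂μ) :
    ∃ lamStar > (0 : ℝ), ∀ lam ≥ lamStar,
      sInf {s : ℝ | ρ ≤ ((compoundPoisson (lam + B) ν) (Iic s)).toReal} <
        sSup {s : ℝ | ρ ≤ 1 - ((compoundPoisson lam μ) (Iic s)).toReal} := by
  obtain ⟨c, hc, hL⟩ := exists_pos_eventually_sInf_le ν (hνnd 0) hν2 hρ0 hρ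
  obtain ⟨d, hd, hU⟩ := exists_pos_eventually_le_sSup μ (hμnd 0) hμ2 hρ0 hρ
  have hsqrt := (Real.tendsto_sqrt_atTop.const_mul_atTop hd).eventually_gt_atTop (B * ∫ x, x ∂ν)
  have hL' := (tendsto_atTop_add_const_right atTop B tendsto_id).eventually hL
  obtain ⟨a, ha⟩ := eventually_atTop.1 ((hL'.and hU).and hsqrt)
  refine ⟨max a 1, by positivity, fun lam hlam => ?_⟩
  obtain ⟨⟨h1, h2⟩, h3⟩ := ha lam ((le_max_left _ _).trans hlam)
  have hpos : 0 ≤ lam := zero_le_one.trans ((le_max_right _ _).trans hlam)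
  refine h1.trans_lt (lt_of_lt_of_le ?_ h2)
  have h4 := mul_le_mul_of_nonneg_left hmean hpos
  have h5 : 0 ≤ c * √(id lam + B) := by positivity
  simp only [id] at h5 ⊢
  linarith
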